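/- If two graphs G_a and G_b are determined to be non-isomorphic by iteration L of the 1-dimensional Weisfeiler-Leman test, and w(l) > 0 for all 0 < l ≤ L+1, and no node feature is the zero vector, then TMD_w^{L+1}(G_a, G_b) > 0. -/

import Mathlib

open scoped BigOperators


noncomputable section

/-- Unnormalized optimal transport between equal-cardinality multisets (represented
as lists): the minimum over bijective matchings of the summed ground costs. -/
noncomputable def listOT {α : Type*} (d : α → α → ℝ) (X Y : List α) : ℝ :=
  sInf {c : ℝ | ∃ Y' : List α, Y.Perm Y' ∧ c = (List.zipWith d X Y').sum}

/-- Blank augmentation `ρ`: pad the smaller multiset with copies of the blank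
element `b` so that both multisets have equal cardinality. -/
def pad {α : Type*} (b : α) (X Y : List α) : List α × List α :=
  (X ++ List.replicate (Y.length - X.length) b,
   Y ++ List.replicate (X.length - Y.length) b)

/-- Blank-augmented unnormalized optimal transport `OT_d(ρ(X, Y))`. -/
noncomputable def otPad {α : Type*} (d : α → α → ℝ) (b : α) (X Y : List α) : ℝ :=
  listOT d (pad b X Y).1 (pad b X Y).2

/-- Rooted trees with node features in `ℝ^p`; children are recorded as a list
(representing the multiset of child subtrees). -/
inductive RTree (p : ℕ) : Type
  | node : EuclideanSpace ℝ (Fin p) → List (RTree p) → RTree p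

namespace RTree

variable {p : ℕ}

/-- The blank tree: a single node with zero feature vector and no children. -/
def blank : RTree p := node 0 []

mutual
  /-- Depth of a rooted tree (a single node has depth 1). -/
  def depth : RTree p → ℕ
    | node _ cs => 1 + depthList cs
  /-- Maximal depth of a list of trees. -/
  def depthList : List (RTree p) → ℕ
    | [] => 0
    | t :: ts => max (depth t) (depthList ts)
end

/-- Tree distance with recursion fuel: `tdAux w n` computes the hierarchical-OT
tree distance `TD_w` correctly whenever `n` is at least the maximal depth. -/
noncomputable def tdAux (w : ℕ → ℝ) : ℕ → RTree p → RTree p → ℝ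
  | 0, _, _ => 0
  | n + 1, node x cs, node y ds =>
      ‖x - y‖ +
        (if 1 < max (node x cs).depth (node y ds).depth then
          w (max (node x cs).depth (node y ds).depth) * otPad (tdAux w n) blank cs ds
        else 0)

/-- The tree distance `TD_w`: distance of root features, plus `w(L)` times the
blank-augmented unnormalized OT between the multisets of child subtrees (with
`TD_w` as the recursive ground cost), `L` being the maximum depth. -/
noncomputable def TD (w : ℕ → ℝ) (Ta Tb : RTree p) : ℝ :=
  tdAux w (max Ta.depth Tb.depth) Ta Tb

/-- Number of nodes at a level of the tree (level `0` is the root, so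
`Width_l(T) = widthAt T (l-1)` in 1-indexed level notation). -/
def widthAt : RTree p → ℕ → ℕ
  | _, 0 => 1
  | node _ cs, l + 1 => (cs.map (fun c => widthAt c l)).sum
termination_by t l => l

/-- Every node feature in the tree is nonzero. -/
inductive NoZero : RTree p → Prop
  | node {x : EuclideanSpace ℝ (Fin p)} {cs : List (RTree p)} :
      x ≠ 0 → (∀ t ∈ cs, NoZero t) → NoZero (RTree.node x cs)

/-- Equivalence of rooted labelled trees up to reordering of children (fuel
version). -/
def equivAux : ℕ → RTree p → RTree p → Prop
  | 0, _, _ => True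
  | n + 1, node x cs, node y ds =>
      x = y ∧ ∃ ds' : List (RTree p), ds.Perm ds' ∧ List.Forall₂ (equivAux n) cs ds'

/-- Two rooted labelled trees are isomorphic: equal roots and children match up
to a bijection level by level. -/
def Equiv' (Ta Tb : RTree p) : Prop := equivAux (max Ta.depth Tb.depth) Ta Tb

end RTree

/-- Depth-`(k+1)` computation tree of node `v`: `compTree G x 0 v` is the single
node `v` with its feature, and the level-`(k+1)` tree attaches the depth-`k`
computation trees of the neighbors of `v`. -/
noncomputable def compTree {V : Type*} [Fintype V] {p : ℕ} (G : SimpleGraph V)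
    [DecidableRel G.Adj] (x : V → EuclideanSpace ℝ (Fin p)) : ℕ → V → RTree p
  | 0, v => RTree.node (x v) []
  | k + 1, v => RTree.node (x v) (((G.neighborFinset v).val.toList).map (compTree G x k))

/-- Tree Mover's Distance `TMD_w^L`: blank-augmented unnormalized OT between the
multisets of depth-`L` computation trees of the two attributed graphs, with the
hierarchical tree distance `TD_w` as ground cost. -/
noncomputable def TMD {Va Vb : Type*} [Fintype Va] [Fintype Vb] {p : ℕ}
    (w : ℕ → ℝ) (L : ℕ)
    (Ga : SimpleGraph Va) [DecidableRel Ga.Adj] (xa : Va → EuclideanSpace ℝ (Fin p))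
    (Gb : SimpleGraph Vb) [DecidableRel Gb.Adj] (xb : Vb → EuclideanSpace ℝ (Fin p)) : ℝ :=
  otPad (RTree.TD w) RTree.blank
    ((Finset.univ.val.toList).map (compTree Ga xa (L - 1)))
    ((Finset.univ.val.toList).map (compTree Gb xb (L - 1)))


noncomputable section

/-- Canonical WL color space: `WLColor p k` is the type of colors after `k`
rounds of refinement (an injective hash is modelled by the identity on this
canonical color space). -/
def WLColor (p : ℕ) : ℕ → Type :=
  fun k => Nat.rec (EuclideanSpace ℝ (Fin p)) (fun _ C => C × Multiset C) k

/-- 1-WL color refinement: `wl G x 0 v = x v` and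
`wl G x (k+1) v = (wl G x k v, {{wl G x k u : u ∈ N(v)}})`. -/
noncomputable def wl {V : Type*} [Fintype V] {p : ℕ} (G : SimpleGraph V)
    [DecidableRel G.Adj] (x : V → EuclideanSpace ℝ (Fin p)) :
    (k : ℕ) → V → WLColor p k
  | 0, v => x v
  | k + 1, v => (wl G x k v, (G.neighborFinset v).val.map (wl G x k))

/-- GIN node embeddings. -/
noncomputable def ginEmb {V : Type*} [Fintype V] {d : ℕ} (G : SimpleGraph V)
    [DecidableRel G.Adj] (x : V → EuclideanSpace ℝ (Fin d))
    (φ : ℕ → EuclideanSpace ℝ (Fin d) → EuclideanSpace ℝ (Fin d)) (ε : ℝ) :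
    ℕ → V → EuclideanSpace ℝ (Fin d)
  | 0, v => x v
  | l + 1, v =>
      φ (l + 1) (ginEmb G x φ ε l v + ε • ∑ u ∈ G.neighborFinset v, ginEmb G x φ ε l u)

/-- GIN graph-level output with readout `ψ`. -/
noncomputable def gin {V : Type*} [Fintype V] {d : ℕ} (G : SimpleGraph V)
    [DecidableRel G.Adj] (x : V → EuclideanSpace ℝ (Fin d))
    (φ : ℕ → EuclideanSpace ℝ (Fin d) → EuclideanSpace ℝ (Fin d)) (ε : ℝ)
    (ψ : EuclideanSpace ℝ (Fin d) → ℝ) (L : ℕ) : ℝ :=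
  ψ (∑ v, ginEmb G x φ ε L v)


theorem listOT_attained {α : Type*} (d : α → α → ℝ) (X Y : List α) :
    ∃ Y' : List α, Y.Perm Y' ∧ listOT d X Y = (List.zipWith d X Y').sum := by
  have hfin : {c : ℝ | ∃ Y' : List α, Y.Perm Y' ∧ c = (List.zipWith d X Y').sum}.Finite := by
    refine (List.finite_toSet (Y.permutations.map fun Y' => (List.zipWith d X Y').sum)).subset ?_
    rintro c ⟨Y', hY, rfl⟩
    exact List.mem_map.2 ⟨Y', List.mem_permutations.2 hY.symm, rfl⟩
  have hne : {c : ℝ | ∃ Y' : List α, Y.Perm Y' ∧ c = (List.zipWith d X Y').sum}.Nonempty :=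
    ⟨_, Y, List.Perm.refl Y, rfl⟩
  exact hne.csInf_mem hfin

theorem sum_zipWith_nonneg {α : Type*} (d : α → α → ℝ) :
    ∀ X Y : List α, (∀ a ∈ X, ∀ b ∈ Y, 0 ≤ d a b) → 0 ≤ (List.zipWith d X Y).sum
  | [], _, _ => by simp
  | _ :: _, [], _ => by simp
  | a :: X, b :: Y, h => by
    have h₁ := h a (by simp) b (by simp)
    have h₂ := sum_zipWith_nonneg d X Y fun a ha b hb =>
      h a (List.mem_cons_of_mem _ ha) b (List.mem_cons_of_mem _ hb)
    simpa using add_nonneg h₁ h₂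

theorem rel_of_sum_zipWith_eq_zero {α : Type*} (d : α → α → ℝ) :
    ∀ X Y : List α, X.length = Y.length → (∀ a ∈ X, ∀ b ∈ Y, 0 ≤ d a b) →
      (List.zipWith d X Y).sum = 0 →
      Multiset.Rel (fun a b => d a b = 0) (X : Multiset α) (Y : Multiset α)
  | [], [], _, _, _ => Multiset.Rel.zero
  | a :: X, b :: Y, hl, h, h0 => by
    have h₁ := h a (by simp) b (by simp)
    have hXY : ∀ a ∈ X, ∀ b ∈ Y, 0 ≤ d a b := fun a ha b hb =>
      h a (List.mem_cons_of_mem _ ha) b (List.mem_cons_of_mem _ hb)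
    have h₂ := sum_zipWith_nonneg d X Y hXY
    simp only [List.zipWith_cons_cons, List.sum_cons] at h0
    exact Multiset.Rel.cons (by linarith)
      (rel_of_sum_zipWith_eq_zero d X Y (by simpa using hl) hXY (by linarith))

theorem otPad_nonneg {α : Type*} (d : α → α → ℝ) (b : α) (X Y : List α) (P : α → Prop)
    (hd : ∀ s t, P s → P t → 0 ≤ d s t) (hb : P b) (hX : ∀ s ∈ X, P s) (hY : ∀ t ∈ Y, P t) :
    0 ≤ otPad d b X Y := by
  obtain ⟨Y', hp, he⟩ := listOT_attained d (pad b X Y).1 (pad b X Y).2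
  rw [otPad, he]
  refine sum_zipWith_nonneg d _ _ fun s hs t ht => hd s t ?_ ?_
  · rcases List.mem_append.1 hs with h | h
    · exact hX s h
    · exact List.eq_of_mem_replicate h ▸ hb
  · rcases List.mem_append.1 (hp.mem_iff.2 ht) with h | h
    · exact hY t h
    · exact List.eq_of_mem_replicate h ▸ hb

/-- A vanishing blank-augmented transport cost yields a zero-cost matching, provided that matching
anything to a blank has positive cost. -/
theorem rel_of_otPad_eq_zero {α : Type*} (d : α → α → ℝ) (b : α) (X Y : List α) (P : α → Prop)
    (hd : ∀ s t, P s → P t → 0 ≤ d s t) (hb : P b) (hX : ∀ s ∈ X, P s) (hY : ∀ t ∈ Y, P t)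
    (hXb : ∀ s ∈ X, 0 < d s b) (hYb : ∀ t ∈ Y, 0 < d b t) (h0 : otPad d b X Y = 0) :
    Multiset.Rel (fun s t => d s t = 0) (X : Multiset α) (Y : Multiset α) := by
  obtain ⟨Y', hp, he⟩ := listOT_attained d (pad b X Y).1 (pad b X Y).2
  have hrel : Multiset.Rel (fun s t => d s t = 0)
      ((pad b X Y).1 : Multiset α) ((pad b X Y).2 : Multiset α) := by
    rw [Multiset.coe_eq_coe.2 hp]
    refine rel_of_sum_zipWith_eq_zero d _ _ ?_ (fun s hs t ht => hd s t ?_ ?_)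
      (he.symm.trans h0)
    · rw [← hp.length_eq]
      simp only [pad, List.length_append, List.length_replicate]
      omega
    · rcases List.mem_append.1 hs with h | h
      · exact hX s h
      · exact List.eq_of_mem_replicate h ▸ hb
    · rcases List.mem_append.1 (hp.mem_iff.2 ht) with h | h
      · exact hY t h
      · exact List.eq_of_mem_replicate h ▸ hb
  rcases lt_trichotomy X.length Y.length with hlt | heq | hgt
  · have hmem : b ∈ ((pad b X Y).1 : Multiset α) :=
      Multiset.mem_coe.2 (List.mem_append_right _ (List.mem_replicate.2 ⟨by omega, rfl⟩))
    obtain ⟨t, ht, h⟩ := Multiset.exists_mem_of_rel_of_mem hrel hmem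
    have ht' : t ∈ Y := by simpa [pad, Nat.sub_eq_zero_of_le hlt.le] using ht
    exact absurd h (hYb t ht').ne'
  · simpa [pad, heq] using hrel
  · have hmem : b ∈ ((pad b X Y).2 : Multiset α) :=
      Multiset.mem_coe.2 (List.mem_append_right _ (List.mem_replicate.2 ⟨by omega, rfl⟩))
    obtain ⟨s, hs, h⟩ := Multiset.exists_mem_of_rel_of_mem (Multiset.rel_flip.2 hrel) hmem
    have hs' : s ∈ X := by simpa [pad, Nat.sub_eq_zero_of_le hgt.le] using hs
    exact absurd h (hXb s hs').ne'

namespace RTree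

theorem one_le_depth {p : ℕ} : ∀ t : RTree p, 1 ≤ t.depth
  | node _ _ => by simp [depth]

theorem depth_blank {p : ℕ} : (blank : RTree p).depth = 1 := by
  simp [blank, depth, depthList]

theorem depthList_le_iff {p : ℕ} (m : ℕ) (cs : List (RTree p)) :
    depthList cs ≤ m ↔ ∀ t ∈ cs, t.depth ≤ m := by
  induction cs with
  | nil => simp [depthList]
  | cons t ts ih => simp [depthList, ih]

theorem depth_node_le_iff {p : ℕ} (m : ℕ) (x : EuclideanSpace ℝ (Fin p)) (cs : List (RTree p)) :
    (node x cs).depth ≤ m + 1 ↔ ∀ t ∈ cs, t.depth ≤ m := by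
  rw [← depthList_le_iff, depth]
  omega

theorem tdAux_nonneg {p : ℕ} (w : ℕ → ℝ) (D : ℕ) (hw : ∀ l, 0 < l → l ≤ D → 0 < w l) (n : ℕ) :
    ∀ s t : RTree p, s.depth ≤ D → t.depth ≤ D → 0 ≤ tdAux w n s t := by
  induction n with
  | zero => intro s t _ _; simp [tdAux]
  | succ n ih =>
    rintro ⟨x, cs⟩ ⟨y, ds⟩ hs ht
    rw [tdAux]
    have h1 := one_le_depth (node x cs)
    obtain ⟨m, rfl⟩ : ∃ m, D = m + 1 := ⟨D - 1, by omega⟩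
    refine add_nonneg (norm_nonneg _) ?_
    split_ifs
    · refine mul_nonneg (hw _ (by omega) (max_le hs ht)).le
        (otPad_nonneg _ _ _ _ (fun t => t.depth ≤ m + 1) ih (by rw [depth_blank]; omega) ?_ ?_)
      · exact fun t h => ((depth_node_le_iff m x cs).1 hs t h).trans (Nat.le_succ m)
      · exact fun t h => ((depth_node_le_iff m y ds).1 ht t h).trans (Nat.le_succ m)
    · exact le_rfl

/-- The tree distance dominates the distance of the roots, and when it vanishes so does the
transport cost between the children. -/
theorem norm_sub_le_tdAux_and_otPad_eq_zero {p : ℕ} (w : ℕ → ℝ) (D : ℕ) (hw : ∀ l, 0 < l → l ≤ D → 0 < w l) (n : ℕ)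
    (x y : EuclideanSpace ℝ (Fin p)) (cs ds : List (RTree p))
    (hs : (node x cs).depth ≤ D) (ht : (node y ds).depth ≤ D) :
    ‖x - y‖ ≤ tdAux w (n + 1) (node x cs) (node y ds) ∧
      (1 < max (node x cs).depth (node y ds).depth →
        tdAux w (n + 1) (node x cs) (node y ds) = 0 → otPad (tdAux w n) blank cs ds = 0) := by
  have h1 := one_le_depth (node x cs)
  obtain ⟨m, rfl⟩ : ∃ m, D = m + 1 := ⟨D - 1, by omega⟩
  have hot : 0 ≤ otPad (tdAux w n) blank cs ds := by
    refine otPad_nonneg _ _ _ _ (fun t => t.depth ≤ m + 1) (tdAux_nonneg w _ hw n)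
      (by rw [depth_blank]; omega) ?_ ?_
    · exact fun t h => ((depth_node_le_iff m x cs).1 hs t h).trans (Nat.le_succ m)
    · exact fun t h => ((depth_node_le_iff m y ds).1 ht t h).trans (Nat.le_succ m)
  have hwm : 0 < w (max (node x cs).depth (node y ds).depth) := hw _ (by omega) (max_le hs ht)
  have hmul := mul_nonneg hwm.le hot
  have hn := norm_nonneg (x - y)
  rw [tdAux]
  constructor
  · split_ifs <;> linarith
  · intro hlt h0
    rw [if_pos hlt] at h0
    have : w (max (node x cs).depth (node y ds).depth) * otPad (tdAux w n) blank cs ds = 0 := by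
      linarith
    exact (mul_eq_zero.1 this).resolve_left hwm.ne'

end RTree

section ComputationTree

variable {V : Type*} [Fintype V] {p : ℕ} (G : SimpleGraph V) [DecidableRel G.Adj]
  (x : V → EuclideanSpace ℝ (Fin p))

theorem compTree_eq_node (k : ℕ) (v : V) : ∃ cs, compTree G x k v = RTree.node (x v) cs := by
  cases k <;> exact ⟨_, rfl⟩

theorem depth_compTree_le (k : ℕ) (v : V) : (compTree G x k v).depth ≤ k + 1 := by
  induction k generalizing v with
  | zero => simp [compTree, RTree.depth, RTree.depthList]
  | succ k ih =>
    rw [compTree, RTree.depth_node_le_iff]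
    intro t ht
    obtain ⟨u, -, rfl⟩ := List.mem_map.1 ht
    exact ih u

end ComputationTree

theorem tdAux_compTree_blank_pos {V : Type*} [Fintype V] {p : ℕ} (G : SimpleGraph V)
    [DecidableRel G.Adj] (x : V → EuclideanSpace ℝ (Fin p)) (w : ℕ → ℝ) (k : ℕ)
    (hw : ∀ l, 0 < l → l ≤ k + 1 → 0 < w l) (n : ℕ) (hn : 0 < n) (v : V) (hv : x v ≠ 0) :
    0 < RTree.tdAux w n (compTree G x k v) RTree.blank ∧
      0 < RTree.tdAux w n RTree.blank (compTree G x k v) := by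
  obtain ⟨n, rfl⟩ : ∃ m, n = m + 1 := ⟨n - 1, by omega⟩
  have hd := depth_compTree_le G x k v
  have hb : (RTree.blank : RTree p).depth ≤ k + 1 := by rw [RTree.depth_blank]; omega
  obtain ⟨cs, hcs⟩ := compTree_eq_node G x k v
  rw [hcs] at hd ⊢
  have h₁ := (RTree.norm_sub_le_tdAux_and_otPad_eq_zero w _ hw n (x v) 0 cs [] hd hb).1
  have h₂ := (RTree.norm_sub_le_tdAux_and_otPad_eq_zero w _ hw n 0 (x v) [] cs hb hd).1
  rw [sub_zero] at h₁
  rw [zero_sub, norm_neg] at h₂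
  have := norm_pos_iff.2 hv
  exact ⟨this.trans_le h₁, this.trans_le h₂⟩

section TwoGraphs

variable {Va Vb : Type*} [Fintype Va] [Fintype Vb] {p : ℕ}
  (Ga : SimpleGraph Va) [DecidableRel Ga.Adj] (xa : Va → EuclideanSpace ℝ (Fin p))
  (Gb : SimpleGraph Vb) [DecidableRel Gb.Adj] (xb : Vb → EuclideanSpace ℝ (Fin p))

/-- Colors at iteration `k + 1` are determined by the node feature and the multiset of neighbor
colors at iteration `k`. -/
theorem wl_succ_eq_of_neighbors (k : ℕ) (u : Va) (v : Vb) (hx : xa u = xb v)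
    (h : (Ga.neighborFinset u).val.map (wl Ga xa k) = (Gb.neighborFinset v).val.map (wl Gb xb k)) :
    wl Ga xa (k + 1) u = wl Gb xb (k + 1) v := by
  induction k with
  | zero => exact Prod.ext hx h
  | succ k ih =>
    refine Prod.ext (ih ?_) h
    let π : WLColor p (k + 1) → WLColor p k := Prod.fst
    have ha := Multiset.map_map π (wl Ga xa (k + 1)) (Ga.neighborFinset u).val
    have hb := Multiset.map_map π (wl Gb xb (k + 1)) (Gb.neighborFinset v).val
    exact ha.symm.trans ((congrArg (Multiset.map π) h).trans hb)

theorem map_eq_of_rel_compTree {C : Type*} (d : RTree p → RTree p → ℝ) (k : ℕ)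
    (A : Multiset Va) (B : Multiset Vb) (f : Va → C) (g : Vb → C)
    (h : Multiset.Rel (fun s t => d s t = 0)
      (A.toList.map (compTree Ga xa k) : Multiset (RTree p))
      (B.toList.map (compTree Gb xb k) : Multiset (RTree p)))
    (hfg : ∀ u ∈ A, ∀ v ∈ B, d (compTree Ga xa k u) (compTree Gb xb k v) = 0 → f u = g v) :
    A.map f = B.map g := by
  rw [← Multiset.map_coe, ← Multiset.map_coe, Multiset.coe_toList, Multiset.coe_toList,
    Multiset.rel_map] at h
  rw [← Multiset.rel_eq, Multiset.rel_map]
  exact h.mono hfg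

/-- Nodes whose computation trees are at tree distance zero have equal WL colors. -/
theorem wl_eq_of_tdAux_eq_zero (hza : ∀ v, xa v ≠ 0) (hzb : ∀ v, xb v ≠ 0) (w : ℕ → ℝ) (k : ℕ)
    (hw : ∀ l, 0 < l → l ≤ k + 1 → 0 < w l) (n : ℕ) (u : Va) (v : Vb)
    (hu : (compTree Ga xa k u).depth ≤ n) (hv : (compTree Gb xb k v).depth ≤ n)
    (h0 : RTree.tdAux w n (compTree Ga xa k u) (compTree Gb xb k v) = 0) :
    wl Ga xa k u = wl Gb xb k v := by
  induction k generalizing n u v with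
  | zero =>
    have h1 := RTree.one_le_depth (compTree Ga xa 0 u)
    obtain ⟨n, rfl⟩ : ∃ m, n = m + 1 := ⟨n - 1, by omega⟩
    have h := (RTree.norm_sub_le_tdAux_and_otPad_eq_zero w 1 hw n (xa u) (xb v) [] []
      (depth_compTree_le Ga xa 0 u) (depth_compTree_le Gb xb 0 v)).1
    have hx : xa u = xb v := sub_eq_zero.1 (norm_le_zero_iff.1 (h.trans_eq h0))
    exact hx
  | succ k ih =>
    have h1 := RTree.one_le_depth (compTree Ga xa (k + 1) u)
    obtain ⟨n, rfl⟩ : ∃ m, n = m + 1 := ⟨n - 1, by omega⟩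
    obtain ⟨hle, hot⟩ := RTree.norm_sub_le_tdAux_and_otPad_eq_zero w _ hw n (xa u) (xb v) _ _
      (depth_compTree_le Ga xa (k + 1) u) (depth_compTree_le Gb xb (k + 1) v)
    have hx : xa u = xb v := sub_eq_zero.1 (norm_le_zero_iff.1 (hle.trans_eq h0))
    have hw' : ∀ l, 0 < l → l ≤ k + 1 → 0 < w l := fun l h h' => hw l h (by omega)
    have hca := (RTree.depth_node_le_iff n _ _).1 hu
    have hcb := (RTree.depth_node_le_iff n _ _).1 hv
    refine wl_succ_eq_of_neighbors Ga xa Gb xb k u v hx ?_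
    have hrel : Multiset.Rel (fun s t => RTree.tdAux w n s t = 0)
        ((Ga.neighborFinset u).val.toList.map (compTree Ga xa k) : Multiset (RTree p))
        ((Gb.neighborFinset v).val.toList.map (compTree Gb xb k) : Multiset (RTree p)) := by
      by_cases hlt : 1 < max (compTree Ga xa (k + 1) u).depth (compTree Gb xb (k + 1) v).depth
      · have hn : 0 < n := by omega
        refine rel_of_otPad_eq_zero _ RTree.blank _ _ (fun t => t.depth ≤ k + 1)
          (RTree.tdAux_nonneg w _ hw' n) (by rw [RTree.depth_blank]; omega) ?_ ?_ ?_ ?_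
          (hot hlt h0)
        all_goals
          intro t ht
          obtain ⟨a, -, rfl⟩ := List.mem_map.1 ht
        · exact depth_compTree_le Ga xa k a
        · exact depth_compTree_le Gb xb k a
        · exact (tdAux_compTree_blank_pos Ga xa w k hw' n hn a (hza a)).1
        · exact (tdAux_compTree_blank_pos Gb xb w k hw' n hn a (hzb a)).2
      · have ha := (RTree.depth_node_le_iff 0 _ _).1 ((le_max_left _ _).trans (not_lt.1 hlt))
        have hb := (RTree.depth_node_le_iff 0 _ _).1 ((le_max_right _ _).trans (not_lt.1 hlt))
        rw [List.eq_nil_iff_forall_not_mem.2 fun t ht =>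
            absurd (ha t ht) (by have := RTree.one_le_depth t; omega),
          List.eq_nil_iff_forall_not_mem.2 fun t ht =>
            absurd (hb t ht) (by have := RTree.one_le_depth t; omega)]
        exact Multiset.Rel.zero
    refine map_eq_of_rel_compTree Ga xa Gb xb _ k _ _ _ _ hrel fun a ha b hb h => ?_
    exact ih hw' n a b
      (hca _ (List.mem_map_of_mem (Multiset.mem_toList.2 ha)))
      (hcb _ (List.mem_map_of_mem (Multiset.mem_toList.2 hb))) h

end TwoGraphs

/-- Discriminative power of TMD: if two graphs are determined non-isomorphic at
iteration `L` of the 1-WL test (their multisets of WL colors differ), the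
weights `w(l)` are positive for `0 < l ≤ L + 1`, and no node feature is the zero
vector, then `TMD_w^{L+1}(G_a, G_b) > 0`. -/
theorem TMD_pos_of_WL_distinguishes {Va Vb : Type*} [Fintype Va] [Fintype Vb]
    {p : ℕ} (L : ℕ) (w : ℕ → ℝ) (hw : ∀ l, 0 < l → l ≤ L + 1 → 0 < w l)
    (Ga : SimpleGraph Va) [DecidableRel Ga.Adj] (xa : Va → EuclideanSpace ℝ (Fin p))
    (Gb : SimpleGraph Vb) [DecidableRel Gb.Adj] (xb : Vb → EuclideanSpace ℝ (Fin p))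
    (hza : ∀ v, xa v ≠ 0) (hzb : ∀ v, xb v ≠ 0)
    (hWL : (Finset.univ.val.map (wl Ga xa L)) ≠ (Finset.univ.val.map (wl Gb xb L))) :
    0 < TMD w (L + 1) Ga xa Gb xb := by
  have hnn : ∀ s t : RTree p, s.depth ≤ L + 1 → t.depth ≤ L + 1 → 0 ≤ RTree.TD w s t :=
    fun s t => RTree.tdAux_nonneg w _ hw _ s t
  have hb : (RTree.blank : RTree p).depth ≤ L + 1 := by rw [RTree.depth_blank]; omega
  have hA : ∀ t ∈ (Finset.univ : Finset Va).val.toList.map (compTree Ga xa L),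
      t.depth ≤ L + 1 := fun t ht => by
    obtain ⟨a, -, rfl⟩ := List.mem_map.1 ht
    exact depth_compTree_le Ga xa L a
  have hB : ∀ t ∈ (Finset.univ : Finset Vb).val.toList.map (compTree Gb xb L),
      t.depth ≤ L + 1 := fun t ht => by
    obtain ⟨a, -, rfl⟩ := List.mem_map.1 ht
    exact depth_compTree_le Gb xb L a
  rw [TMD, Nat.add_sub_cancel]
  refine lt_of_le_of_ne
    (otPad_nonneg _ _ _ _ (fun t => t.depth ≤ L + 1) hnn hb hA hB) fun h0 => hWL ?_
  have hrel := rel_of_otPad_eq_zero _ _ _ _ (fun t => t.depth ≤ L + 1) hnn hb hA hB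
    (fun t ht => by
      obtain ⟨a, -, rfl⟩ := List.mem_map.1 ht
      exact (tdAux_compTree_blank_pos Ga xa w L hw _
        (lt_max_of_lt_left (RTree.one_le_depth _)) a (hza a)).1)
    (fun t ht => by
      obtain ⟨a, -, rfl⟩ := List.mem_map.1 ht
      exact (tdAux_compTree_blank_pos Gb xb w L hw _
        (lt_max_of_lt_left (RTree.one_le_depth _)) a (hzb a)).2)
    h0.symm
  exact map_eq_of_rel_compTree Ga xa Gb xb _ L _ _ _ _ hrel fun u _ v _ h =>
    wl_eq_of_tdAux_eq_zero Ga xa Gb xb hza hzb w L hw _ u v (le_max_left _ _) (le_max_right _ _) h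

end
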